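/- arXiv:1803.06461 — 2 statements merged into one kernel-verified Lean document; each statement's English description precedes it below -/
import Mathlib

section
/- Let p be a prime, m ≥ 1 an integer, q = pᵐ, and let F_q denote the field with q elements. Let A be a commutative F_q-algebra of finite type and f : A → A a homomorphism of F_q-algebras. Let I ⊆ A be the ideal generated by the set { f(a)^q − a : a ∈ A }. Then the quotient F_q-algebra A/I is étale over F_q (i.e., it is formally étale and of finite presentation over F_q). -/
universe u

/-- Let `q = pᵐ` with `p` prime and `m ≥ 1`, let `F_q` be the field with `q` elements,
let `A` be a commutative `F_q`-algebra of finite type and `f : A → A` a homomorphism of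
`F_q`-algebras.  If `I ⊆ A` is the ideal generated by the elements `f(a) ^ q - a` for
`a ∈ A`, then the quotient `F_q`-algebra `A ⧸ I` is étale over `F_q`, i.e. it is
formally étale and of finite presentation over `F_q`. -/
theorem fixedPointAlgebra_etale
    (p m q : ℕ) (hp : p.Prime) (hm : 1 ≤ m) (hq : q = p ^ m)
    (Fq : Type u) [Field Fq] [Fintype Fq] (hcard : Fintype.card Fq = q)
    (A : Type u) [CommRing A] [Algebra Fq A] [Algebra.FiniteType Fq A]
    (f : A →ₐ[Fq] A)
    (I : Ideal A) (hI : I = Ideal.span {x : A | ∃ a : A, x = f a ^ q - a}) :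
    Algebra.FormallyEtale Fq (A ⧸ I) ∧ Algebra.FinitePresentation Fq (A ⧸ I) := by
  have hpow : ∀ x : A ⧸ I, ∃ y : A ⧸ I, x = y ^ q := by
    intro x
    obtain ⟨a, rfl⟩ := Ideal.Quotient.mk_surjective x
    refine ⟨Ideal.Quotient.mk I (f a), ?_⟩
    rw [← map_pow, eq_comm, Ideal.Quotient.eq, hI]
    exact Ideal.subset_span ⟨a, rfl⟩
  have hq0 : (q : A ⧸ I) = 0 := by
    have h : (q : Fq) = 0 := by rw [← hcard]; exact Nat.cast_card_eq_zero Fq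
    rw [← map_natCast (algebraMap Fq (A ⧸ I)), h, map_zero]
  have : Algebra.FiniteType Fq (A ⧸ I) :=
    Algebra.FiniteType.of_surjective (Ideal.Quotient.mkₐ Fq I) Ideal.Quotient.mk_surjective
  have : Algebra.FormallyUnramified Fq (A ⧸ I) := by
    constructor
    rw [← Submodule.subsingleton_iff (A ⧸ I), ← subsingleton_iff_bot_eq_top, eq_comm,
      ← KaehlerDifferential.span_range_derivation, Submodule.span_eq_bot]
    rintro _ ⟨x, rfl⟩
    obtain ⟨y, rfl⟩ := hpow x
    rw [Derivation.leibniz_pow, ← Nat.cast_smul_eq_nsmul (A ⧸ I), hq0, zero_smul]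
  exact ⟨Algebra.FormallyEtale.of_formallyUnramified_of_field Fq (A ⧸ I),
    Algebra.FinitePresentation.of_finiteType.mp inferInstance⟩
end

section
/- Let p be a prime, q a power of p, and k an algebraic closure of the field F_q with q elements. Let M = (m_{ij}) ∈ GL₂(ℤ) be an invertible integer matrix and let n ≥ 1 be an integer such that det(1 − qⁿM) ≠ 0. Consider the group endomorphism of (kˣ)² sending (x, y) ↦ (x^{m₁₁} y^{m₁₂}, x^{m₂₁} y^{m₂₂}) (using integer powers in the group of units), and let Φ : (kˣ)² → (kˣ)² be the map obtained by first raising both coordinates to the qⁿ-th power and then applying this endomorphism. Then the set of fixed points { (x,y) ∈ (kˣ)² : Φ(x,y) = (x,y) } is finite of cardinality |det(1 − qⁿM)|. -/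
theorem aux_root {k : Type*} [Field k] [IsAlgClosed k] (N : ℤ) (hN : (N : k) ≠ 0) (c : kˣ) :
    Nat.card {x : kˣ // x ^ N = c} = N.natAbs := by
  have key : ∀ (m : ℕ), (m : k) ≠ 0 → ∀ c : kˣ, Nat.card {x : kˣ // x ^ m = c} = m := by
    intro m hm c
    have hm0 : m ≠ 0 := by rintro rfl; simp at hm
    have : NeZero (m : k) := ⟨hm⟩
    have : NeZero m := ⟨hm0⟩
    obtain ⟨z, hz⟩ := IsAlgClosed.exists_pow_nat_eq (c : k) (Nat.pos_of_ne_zero hm0)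
    have hz0 : z ≠ 0 := by
      rintro rfl
      rw [zero_pow hm0] at hz
      exact c.ne_zero hz.symm
    obtain ⟨w, rfl⟩ : ∃ w : kˣ, (w : k) = z := ⟨Units.mk0 z hz0, rfl⟩
    have hw : w ^ m = c := by ext; simpa using hz
    obtain ⟨ζ, hζ⟩ := HasEnoughRootsOfUnity.exists_primitiveRoot k m
    have e : {x : kˣ // x ^ m = c} ≃ rootsOfUnity m k :=
      { toFun := fun x => ⟨x.1 * w⁻¹, by
          rw [mem_rootsOfUnity, mul_pow, inv_pow, x.2, hw, mul_inv_cancel]⟩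
        invFun := fun y => ⟨y.1 * w, by
          rw [mul_pow, hw, (mem_rootsOfUnity m _).1 y.2, one_mul]⟩
        left_inv := fun x => by simp
        right_inv := fun y => by simp }
    rw [Nat.card_congr e, hζ.card_rootsOfUnity]
  obtain ⟨m, rfl | rfl⟩ := N.eq_nat_or_neg
  · simpa using key m (by simpa using hN) c
  · have := key m (by simpa using hN) c⁻¹
    simp only [Int.natAbs_neg, Int.natAbs_natCast, zpow_neg, zpow_natCast, inv_eq_iff_eq_inv]
    exact this

theorem aux_count {k : Type*} [Field k] [IsAlgClosed k] (a b c e : ℤ)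
    (hd : ((a * e - c * b : ℤ) : k) ≠ 0) :
    Nat.card {v : kˣ × kˣ // v.1 ^ a * v.2 ^ b = 1 ∧ v.1 ^ c * v.2 ^ e = 1} =
      (a * e - c * b).natAbs := by
  obtain ⟨g, a', c', u, w, ha, hc, h1⟩ : ∃ g a' c' u w : ℤ, a = g * a' ∧ c = g * c' ∧
      u * a' + w * c' = 1 := by
    have hne : (Int.gcd a c : ℤ) ≠ 0 := by
      intro h
      have h0 : Int.gcd a c = 0 := by exact_mod_cast h
      rw [Int.gcd_eq_zero_iff] at h0
      apply hd
      rw [h0.1, h0.2]; simp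
    obtain ⟨a', ha⟩ := Int.gcd_dvd_left a c
    obtain ⟨c', hc⟩ := Int.gcd_dvd_right a c
    refine ⟨_, a', c', Int.gcdA a c, Int.gcdB a c, ha, hc, ?_⟩
    have hb := Int.gcd_eq_gcd_ab a c
    apply mul_left_cancel₀ hne
    linear_combination (-1) * hb - Int.gcdA a c * ha - Int.gcdB a c * hc
  have hD : a * e - c * b = (a' * e - c' * b) * g := by rw [ha, hc]; ring
  set D := a' * e - c' * b with hDdef
  set t := u * b + w * e with ht
  rw [hD, Int.cast_mul] at hd
  have hDk := left_ne_zero_of_mul hd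
  have hgk := right_ne_zero_of_mul hd
  have hiff : ∀ x y : kˣ, (x ^ a * y ^ b = 1 ∧ x ^ c * y ^ e = 1) ↔
      (y ^ D = 1 ∧ x ^ g = y ^ (-t)) := by
    intro x y
    have E1 : (x ^ a * y ^ b) ^ u * (x ^ c * y ^ e) ^ w = x ^ g * y ^ t := by
      have h1' : g = a * u + c * w := by rw [ha, hc]; linear_combination (-g) * h1
      rw [h1', ht]
      simp only [mul_zpow, ← zpow_mul, zpow_add, mul_comm u, mul_comm w]
      exact mul_mul_mul_comm _ _ _ _
    have E2 : (x ^ a * y ^ b) ^ (-c') * (x ^ c * y ^ e) ^ a' = y ^ D := by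
      rw [mul_zpow, mul_zpow, mul_mul_mul_comm]
      simp only [← zpow_mul, ← zpow_add]
      rw [show a * -c' + c * a' = 0 by rw [ha, hc]; ring,
        show b * -c' + e * a' = D by rw [hDdef]; ring, zpow_zero, one_mul]
    have E3 : x ^ a * y ^ b = (x ^ g * y ^ t) ^ a' * (y ^ D) ^ (-w) := by
      rw [mul_zpow, mul_assoc]
      simp only [← zpow_mul, ← zpow_add]
      rw [← ha, show t * a' + D * -w = b by rw [hDdef, ht]; linear_combination b * h1]
    have E4 : x ^ c * y ^ e = (x ^ g * y ^ t) ^ c' * (y ^ D) ^ u := by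
      rw [mul_zpow, mul_assoc]
      simp only [← zpow_mul, ← zpow_add]
      rw [← hc, show t * c' + D * u = e by rw [hDdef, ht]; linear_combination e * h1]
    rw [zpow_neg, ← mul_eq_one_iff_eq_inv]
    constructor
    · rintro ⟨p1, p2⟩
      rw [← E1, ← E2, p1, p2]; simp
    · rintro ⟨p1, p2⟩
      rw [E3, E4, p1, p2]; simp
  have eq : {v : kˣ × kˣ // v.1 ^ a * v.2 ^ b = 1 ∧ v.1 ^ c * v.2 ^ e = 1} ≃
      Σ y : {y : kˣ // y ^ D = 1}, {x : kˣ // x ^ g = y.1 ^ (-t)} :=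
    { toFun := fun v => ⟨⟨v.1.2, ((hiff _ _).1 v.2).1⟩, ⟨v.1.1, ((hiff _ _).1 v.2).2⟩⟩
      invFun := fun s => ⟨(s.2.1, s.1.1), (hiff _ _).2 ⟨s.1.2, s.2.2⟩⟩
      left_inv := fun v => rfl
      right_inv := fun s => rfl }
  have hcD := aux_root (k := k) D hDk 1
  have hD0 : D ≠ 0 := by rintro h; rw [h] at hDk; simp at hDk
  have hg0 : g ≠ 0 := by rintro h; rw [h] at hgk; simp at hgk
  have : Finite {y : kˣ // y ^ D = 1} := Nat.finite_of_card_ne_zero (by rw [hcD]; simpa using hD0)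
  have := Fintype.ofFinite {y : kˣ // y ^ D = 1}
  have : ∀ y : {y : kˣ // y ^ D = 1}, Finite {x : kˣ // x ^ g = y.1 ^ (-t)} := fun y =>
    Nat.finite_of_card_ne_zero (by rw [aux_root g hgk]; simpa using hg0)
  rw [Nat.card_congr eq, Nat.card_sigma, hD, Int.natAbs_mul, ← hcD]
  simp only [aux_root g hgk]
  simp

/-- Let `k` be an algebraic closure of the field `F_q` with `q` elements, `q` a power of a
prime `p`.  Let `M ∈ GL₂(ℤ)` and `n ≥ 1` with `det (1 - qⁿ M) ≠ 0`.  The self map `Φ` of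
`(kˣ)²` obtained by first raising both coordinates to the `qⁿ`-th power and then applying
the group endomorphism `(x, y) ↦ (x^{m₁₁} y^{m₁₂}, x^{m₂₁} y^{m₂₂})` associated to `M`
has exactly `|det (1 - qⁿ M)|` fixed points. -/
theorem card_fixedPoints_torus
    (p m q : ℕ) (hp : p.Prime) (hm : 1 ≤ m) (hq : q = p ^ m)
    (Fq : Type*) [Field Fq] [Fintype Fq] (hcard : Fintype.card Fq = q)
    (k : Type*) [Field k] [Algebra Fq k] [IsAlgClosure Fq k]
    (M : Matrix (Fin 2) (Fin 2) ℤ) (hM : IsUnit M.det)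
    (n : ℕ) (hn : 1 ≤ n)
    (hdet : ((1 : Matrix (Fin 2) (Fin 2) ℤ) - ((q : ℤ) ^ n) • M).det ≠ 0) :
    {v : kˣ × kˣ |
        ((v.1 ^ (q ^ n)) ^ (M 0 0) * (v.2 ^ (q ^ n)) ^ (M 0 1),
          (v.1 ^ (q ^ n)) ^ (M 1 0) * (v.2 ^ (q ^ n)) ^ (M 1 1)) = v}.Finite ∧
      {v : kˣ × kˣ |
        ((v.1 ^ (q ^ n)) ^ (M 0 0) * (v.2 ^ (q ^ n)) ^ (M 0 1),
          (v.1 ^ (q ^ n)) ^ (M 1 0) * (v.2 ^ (q ^ n)) ^ (M 1 1)) = v}.ncard =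
        (((1 : Matrix (Fin 2) (Fin 2) ℤ) - ((q : ℤ) ^ n) • M).det).natAbs := by
  have : IsAlgClosed k := IsAlgClosure.isAlgClosed Fq
  have hqk : (q : k) = 0 := by
    have h : (q : Fq) = 0 := by rw [← hcard]; exact Nat.cast_card_eq_zero Fq
    have := congrArg (algebraMap Fq k) h
    simpa using this
  set d := ((1 : Matrix (Fin 2) (Fin 2) ℤ) - ((q : ℤ) ^ n) • M).det with hd
  have hd' : d = (1 - (q : ℤ) ^ n * M 0 0) * (1 - (q : ℤ) ^ n * M 1 1)
      - (-((q : ℤ) ^ n * M 1 0)) * (-((q : ℤ) ^ n * M 0 1)) := by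
    rw [hd, Matrix.det_fin_two]
    simp only [Matrix.sub_apply, Matrix.smul_apply, smul_eq_mul, Matrix.one_apply_eq,
      Matrix.one_apply_ne (zero_ne_one : (0 : Fin 2) ≠ 1),
      Matrix.one_apply_ne (one_ne_zero : (1 : Fin 2) ≠ 0)]
    ring
  have hdk : (d : k) ≠ 0 := by
    rw [hd']
    push_cast
    rw [hqk, zero_pow (by omega)]
    simp
  have hc := aux_count (k := k) (1 - (q : ℤ) ^ n * M 0 0) (-((q : ℤ) ^ n * M 0 1))
    (-((q : ℤ) ^ n * M 1 0)) (1 - (q : ℤ) ^ n * M 1 1) (by rw [← hd']; exact hdk)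
  rw [← hd'] at hc
  have hset : {v : kˣ × kˣ |
        ((v.1 ^ (q ^ n)) ^ (M 0 0) * (v.2 ^ (q ^ n)) ^ (M 0 1),
          (v.1 ^ (q ^ n)) ^ (M 1 0) * (v.2 ^ (q ^ n)) ^ (M 1 1)) = v} =
      {v : kˣ × kˣ | v.1 ^ (1 - (q : ℤ) ^ n * M 0 0) * v.2 ^ (-((q : ℤ) ^ n * M 0 1)) = 1 ∧
        v.1 ^ (-((q : ℤ) ^ n * M 1 0)) * v.2 ^ (1 - (q : ℤ) ^ n * M 1 1) = 1} := by
    ext ⟨x, y⟩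
    have hpow : ∀ (z : kˣ) (i : ℤ), (z ^ (q ^ n)) ^ i = z ^ ((q : ℤ) ^ n * i) := by
      intro z i
      rw [zpow_mul]
      congr 1
    simp only [Set.mem_ofPred_eq, Prod.mk.injEq, hpow, zpow_sub, zpow_neg, zpow_one]
    apply and_congr
    · rw [mul_assoc, ← mul_inv, mul_inv_eq_one]
      exact eq_comm
    · rw [mul_left_comm, ← mul_inv, mul_inv_eq_one]
      exact eq_comm
  rw [hset]
  refine ⟨?_, hc⟩
  apply Set.finite_of_ncard_ne_zero
  intro h0
  have h1 : d.natAbs = 0 := hc.symm.trans h0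
  exact hdet (Int.natAbs_eq_zero.1 h1)
end
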